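/- Let (H_i)_{i∈ι} and (K_i)_{i∈ι} be families of complex Hilbert spaces and T_i : H_i → K_i bounded linear operators with sup_i ‖T_i‖ < ∞. Let H = ⊕̂_i H_i and K = ⊕̂_i K_i be the Hilbert direct sums, and let T : H → K be a bounded linear operator satisfying T(single_i x) = single_i (T_i x) for every i ∈ ι and x ∈ H_i (such a T exists and is uniquely determined). The following are equivalent: (1) the range of T is closed; (2) there exists ε > 0 such that for every i, the spectrum of T_i T_i* is contained in {0} ∪ [ε, ∞); (3) there exists ε > 0 such that for every i, the spectrum of T_i* T_i is contained in {0} ∪ [ε, ∞). -/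

import Mathlib

namespace ContinuousLinearMap

section Spectrum

variable {𝕜 E F : Type*} [NontriviallyNormedField 𝕜]
  [NormedAddCommGroup E] [NormedSpace 𝕜 E] [NormedAddCommGroup F] [NormedSpace 𝕜 F]

theorem isUnit_algebraMap_sub_comp_swap (A : E →L[𝕜] F) (B : F →L[𝕜] E) {z : 𝕜} (hz : z ≠ 0)
    (h : IsUnit (algebraMap 𝕜 (F →L[𝕜] F) z - A ∘L B)) :
    IsUnit (algebraMap 𝕜 (E →L[𝕜] E) z - B ∘L A) := by
  obtain ⟨R, hR₁, hR₂⟩ := isUnit_iff_exists.mp h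
  have h₁ : ∀ y, z • R y - A (B (R y)) = y := fun y => by
    simpa [Algebra.algebraMap_eq_smul_one] using DFunLike.congr_fun hR₁ y
  have h₂ : ∀ y, z • R y - R (A (B y)) = y := fun y => by
    simpa [Algebra.algebraMap_eq_smul_one] using DFunLike.congr_fun hR₂ y
  refine isUnit_iff_exists.mpr ⟨z⁻¹ • (1 + B ∘L R ∘L A), ?_, ?_⟩
  · ext x
    have h := congrArg B (h₁ (A x))
    simp only [map_sub, map_smul] at h
    rw [sub_eq_iff_eq_add] at h
    have hx : B (R (A x)) = z⁻¹ • B (A x) + z⁻¹ • B (A (B (R (A x)))) := by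
      rw [← smul_add, ← h, inv_smul_smul₀ hz]
    simp [Algebra.algebraMap_eq_smul_one, smul_smul, hz, ← hx]
  · ext x
    have h := congrArg B (h₂ (A x))
    simp only [map_sub, map_smul] at h
    rw [sub_eq_iff_eq_add] at h
    simp [Algebra.algebraMap_eq_smul_one, h, hz, smul_sub]

theorem spectrum_comp_swap_subset_insert_zero (A : E →L[𝕜] F) (B : F →L[𝕜] E) {s : Set 𝕜}
    (h : spectrum 𝕜 (A ∘L B) ⊆ insert 0 s) : spectrum 𝕜 (B ∘L A) ⊆ insert 0 s := by
  intro z hz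
  by_cases hz₀ : z = 0
  · exact Or.inl hz₀
  · exact h fun hu => hz (isUnit_algebraMap_sub_comp_swap A B hz₀ hu)

end Spectrum

section ReducedModulus

variable {E F : Type*} [NormedAddCommGroup E] [InnerProductSpace ℂ E]
  [NormedAddCommGroup F] [InnerProductSpace ℂ F]

/-- `T` is bounded below by `c` on the orthogonal complement of its kernel. -/
def IsBoundedBelowOffKer (T : E →L[ℂ] F) (c : ℝ) : Prop :=
  ∀ x ∈ T.kerᗮ, c * ‖x‖ ≤ ‖T x‖

theorem injective_comp_subtypeL_orthogonal_ker (T : E →L[ℂ] F) :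
    Function.Injective (T ∘L T.kerᗮ.subtypeL) := by
  rw [injective_iff_map_eq_zero]
  rintro ⟨x, hx⟩ h
  have hx' : x ∈ T.ker := by simpa using h
  exact Subtype.ext (inner_self_eq_zero.mp (hx x hx'))

variable [CompleteSpace E]

theorem range_comp_subtypeL_orthogonal_ker (T : E →L[ℂ] F) :
    Set.range (T ∘L T.kerᗮ.subtypeL) = Set.range T := by
  refine subset_antisymm (Set.range_comp_subset_range T.kerᗮ.subtypeL T) ?_
  rintro _ ⟨x, rfl⟩
  obtain ⟨k, hk, m, hm, rfl⟩ := T.ker.exists_add_mem_mem_orthogonal x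
  exact ⟨⟨m, hm⟩, by simpa using hk⟩

variable [CompleteSpace F]

theorem isClosed_range_iff_exists_isBoundedBelowOffKer (T : E →L[ℂ] F) :
    IsClosed (Set.range T) ↔ ∃ c, 0 < c ∧ T.IsBoundedBelowOffKer c := by
  rw [← range_comp_subtypeL_orthogonal_ker,
    isClosed_range_iff_antilipschitz_of_injective _ T.injective_comp_subtypeL_orthogonal_ker]
  constructor
  · rintro ⟨C, hC⟩
    refine ⟨(C + 1 : ℝ)⁻¹, by positivity, fun x hx => ?_⟩
    have h := hC.le_mul_dist ⟨x, hx⟩ 0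
    simp only [map_zero, dist_zero_right, coe_comp, Function.comp_apply,
      Submodule.subtypeL_apply] at h
    change ‖x‖ ≤ C * ‖T x‖ at h
    rw [inv_mul_le_iff₀ (by positivity)]
    nlinarith [norm_nonneg (T x)]
  · rintro ⟨c, hc, h⟩
    refine ⟨c⁻¹.toNNReal, AddMonoidHomClass.antilipschitz_of_bound _ fun x => ?_⟩
    rw [Real.coe_toNNReal _ (by positivity), ← div_eq_inv_mul, le_div_iff₀ hc, mul_comm]
    exact h x x.2

theorem IsBoundedBelowOffKer.isUnit_algebraMap_sub {T : E →L[ℂ] F} {c t : ℝ}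
    (h : T.IsBoundedBelowOffKer c) (hc : 0 ≤ c) (ht : 0 < t) (htc : t < c ^ 2) :
    IsUnit (algebraMap ℂ (E →L[ℂ] E) t - adjoint T ∘L T) := by
  set R := T.ker.reflection
  have hR : IsUnit (R.toContinuousLinearEquiv : E →L[ℂ] E) :=
    ⟨ContinuousLinearEquiv.toUnit R.toContinuousLinearEquiv, rfl⟩
  have hδ : 0 < min t (c ^ 2 - t) := lt_min ht (by linarith)
  set D := algebraMap ℂ (E →L[ℂ] E) t - adjoint T ∘L T
  suffices hu : IsUnit ((R.toContinuousLinearEquiv : E →L[ℂ] E) * D) by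
    obtain ⟨u, hu'⟩ := hR
    rw [← hu'] at hu
    exact (Units.isUnit_units_mul u D).mp hu
  refine isUnit_of_forall_le_norm_inner_map _ (c := ⟨_, hδ.le⟩) hδ fun x => ?_
  obtain ⟨k, hk, m, hm, rfl⟩ := T.ker.exists_add_mem_mem_orthogonal x
  have hTk : T k = 0 := by simpa using hk
  have hRx : R (k + m) = k - m := by
    rw [map_add, T.ker.reflection_mem_subspace_eq_self hk,
      T.ker.reflection_mem_subspace_orthogonalComplement_eq_neg hm, sub_eq_add_neg]
  have hkm : inner ℂ k m = 0 := hm k hk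
  have hmk : inner ℂ m k = 0 := inner_eq_zero_symm.mp hkm
  have key : inner ℂ (R (D (k + m))) (k + m) =
      ((t * ‖k‖ ^ 2 + (‖T m‖ ^ 2 - t * ‖m‖ ^ 2) : ℝ) : ℂ) := by
    have : inner ℂ (R (D (k + m))) (k + m) = inner ℂ (D (k + m)) (R (k + m)) := by
      rw [← R.inner_map_map (D (k + m)), T.ker.reflection_reflection]
    rw [this, hRx]
    simp [D, Algebra.algebraMap_eq_smul_one, adjoint_inner_left, hTk, hkm, hmk, inner_self_eq_norm_sq_to_K]
    ring
  have hnorm : ‖k + m‖ ^ 2 = ‖k‖ ^ 2 + ‖m‖ ^ 2 := by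
    simpa [sq] using norm_add_sq_eq_norm_sq_add_norm_sq_of_inner_eq_zero k m hkm
  have hTm : c ^ 2 * ‖m‖ ^ 2 ≤ ‖T m‖ ^ 2 := by
    rw [← mul_pow]
    exact pow_le_pow_left₀ (by positivity) (h m hm) 2
  change ‖k + m‖ ^ 2 * min t (c ^ 2 - t) ≤ ‖inner ℂ (R (D (k + m))) (k + m)‖
  rw [key, Complex.norm_real, hnorm]
  refine le_trans ?_ (le_abs_self _)
  nlinarith [mul_le_mul_of_nonneg_left (min_le_left t (c ^ 2 - t)) (sq_nonneg ‖k‖),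
    mul_le_mul_of_nonneg_left (min_le_right t (c ^ 2 - t)) (sq_nonneg ‖m‖)]

theorem IsBoundedBelowOffKer.spectrum_subset {T : E →L[ℂ] F} {c : ℝ}
    (h : T.IsBoundedBelowOffKer c) (hc : 0 ≤ c) :
    spectrum ℂ (adjoint T ∘L T) ⊆ insert (0 : ℂ) {z : ℂ | ∃ t : ℝ, c ^ 2 ≤ t ∧ z = t} := by
  intro z hz
  have hpos : 0 ≤ adjoint T ∘L T := (nonneg_iff_isPositive _).mpr (isPositive_adjoint_comp_self T)
  have hre : z = z.re := (IsSelfAdjoint.of_nonneg hpos).mem_spectrum_eq_re hz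
  rw [hre] at hz
  have h0 : 0 ≤ z.re :=
    spectrum_nonneg_of_nonneg hpos ((spectrum.algebraMap_mem_iff ℂ).mp hz)
  rcases h0.eq_or_lt with h0 | h0
  · exact Or.inl (by rw [hre, ← h0, Complex.ofReal_zero])
  · refine Or.inr ⟨z.re, ?_, hre⟩
    by_contra! hlt
    exact hz (h.isUnit_algebraMap_sub hc h0 hlt)

theorem isBoundedBelowOffKer_of_spectrum_subset {T : E →L[ℂ] F} {ε : ℝ} (hε : 0 ≤ ε)
    (h : spectrum ℂ (T ∘L adjoint T) ⊆ insert (0 : ℂ) {z : ℂ | ∃ t : ℝ, ε ≤ t ∧ z = t}) :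
    T.IsBoundedBelowOffKer (√ε) := by
  set S := T ∘L adjoint T with hS
  have hpos : S.IsPositive := isPositive_self_comp_adjoint T
  have hsa : IsSelfAdjoint S := hpos.isSelfAdjoint
  have hcfc : cfc (fun t : ℝ => t ^ 2 - ε * t) S = S ^ 2 - ε • S := by
    rw [cfc_sub (fun t : ℝ => t ^ 2) (fun t : ℝ => ε * t) S, cfc_pow_id S 2,
      cfc_const_mul_id ε S]
  have hnn : 0 ≤ S ^ 2 - ε • S := by
    rw [← hcfc]
    refine cfc_nonneg fun t ht => ?_
    rcases h (spectrum.algebraMap_mem ℂ ht) with h0 | ⟨s, hs, hst⟩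
    · have : t = 0 := by simpa using h0
      simp [this]
    · have : t = s := by simpa using hst
      subst this
      nlinarith
  intro x hx
  rw [orthogonal_ker] at hx
  have hclosed : IsClosed {x : E | √ε * ‖x‖ ≤ ‖T x‖} :=
    isClosed_le (by fun_prop) (by fun_prop)
  refine closure_minimal ?_ hclosed hx
  rintro _ ⟨y, rfl⟩
  have hy := ((nonneg_iff_isPositive _).mp hnn).re_inner_nonneg_left y
  have e₁ : inner ℂ ((S ^ 2) y) y = (‖S y‖ : ℂ) ^ 2 := by
    change inner ℂ (S (S y)) y = _
    rw [← adjoint_inner_right, hsa.adjoint_eq, inner_self_eq_norm_sq_to_K]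
    rfl
  have e₂ : inner ℂ (S y) y = (‖adjoint T y‖ : ℂ) ^ 2 := by
    rw [hS, comp_apply, ← adjoint_inner_right, inner_self_eq_norm_sq_to_K]
    rfl
  have e₃ : (ε • S) y = (ε : ℂ) • S y := by simp
  rw [sub_apply, inner_sub_left, e₃, inner_smul_left, e₁, e₂] at hy
  have hy' : ε * ‖adjoint T y‖ ^ 2 ≤ ‖S y‖ ^ 2 := by
    have : 0 ≤ ‖S y‖ ^ 2 - ε * ‖adjoint T y‖ ^ 2 := by
      rw [Complex.conj_ofReal] at hy
      norm_cast at hy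
    linarith
  change √ε * ‖adjoint T y‖ ≤ ‖S y‖
  refine le_of_sq_le_sq ?_ (norm_nonneg _)
  rwa [mul_pow, Real.sq_sqrt hε]

end ReducedModulus

end ContinuousLinearMap

section HilbertSum

open ContinuousLinearMap

variable {ι : Type*} [DecidableEq ι] {H K : ι → Type*}
  [∀ i, NormedAddCommGroup (H i)] [∀ i, InnerProductSpace ℂ (H i)]
  [∀ i, NormedAddCommGroup (K i)] [∀ i, InnerProductSpace ℂ (K i)]
  {T : ∀ i, H i →L[ℂ] K i} {Tsum : lp H 2 →L[ℂ] lp K 2}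

theorem lp.apply_of_apply_single
    (hTsum : ∀ (i : ι) (x : H i), Tsum (lp.single 2 i x) = lp.single 2 i (T i x))
    (x : lp H 2) (i : ι) : Tsum x i = T i (x i) := by
  have h := (lp.hasSum_single (by simp) x).mapL (lp.evalCLM ℂ K 2 i ∘L Tsum)
  have hi : HasSum (fun j => (lp.evalCLM ℂ K 2 i ∘L Tsum) (lp.single 2 j (x j))) (T i (x i)) := by
    convert hasSum_single i fun j hj => ?_ using 1
    · simp [hTsum, lp.evalCLM]
    · simp [hTsum, lp.evalCLM, hj.symm]
  exact h.unique hi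

theorem lp.isBoundedBelowOffKer_iff
    (hTsum : ∀ (i : ι) (x : H i), Tsum (lp.single 2 i x) = lp.single 2 i (T i x))
    {c : ℝ} (hc : 0 ≤ c) :
    Tsum.IsBoundedBelowOffKer c ↔ ∀ i, (T i).IsBoundedBelowOffKer c := by
  have hT := lp.apply_of_apply_single hTsum
  constructor
  · intro h i x hx
    have hmem : lp.single 2 i x ∈ Tsum.kerᗮ := by
      intro y hy
      have hy' : Tsum y = 0 := by simpa using hy
      rw [lp.inner_single_right]
      exact hx _ (by simp [← hT, hy'])
    simpa [hTsum, lp.norm_single] using h _ hmem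
  · intro h x hx
    have hmem : ∀ i, x i ∈ (T i).kerᗮ := by
      intro i y hy
      have hy' : T i y = 0 := by simpa using hy
      rw [← lp.inner_single_left]
      exact hx _ (by simp [hTsum, hy'])
    have h₁ := (lp.hasSum_norm (by simp) x).mul_left (c ^ 2)
    have h₂ := lp.hasSum_norm (by simp) (Tsum x)
    simp only [ENNReal.toReal_ofNat, Real.rpow_ofNat] at h₁ h₂
    refine le_of_sq_le_sq ?_ (norm_nonneg _)
    rw [mul_pow]
    refine hasSum_le (fun i => ?_) h₁ h₂
    rw [hT, ← mul_pow]
    exact pow_le_pow_left₀ (by positivity) (h i _ (hmem i)) 2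

end HilbertSum

/-- Let `(T i : H i → K i)` be a uniformly bounded family of operators
between complex Hilbert spaces and let `T : ⊕̂ᵢ H i → ⊕̂ᵢ K i` be the bounded operator on
the Hilbert direct sums determined by `T (single i x) = single i (T i x)`.  TFAE:
(1) `range T` is closed; (2) ∃ ε > 0, ∀ i, `spectrum (Tᵢ Tᵢ*) ⊆ {0} ∪ [ε, ∞)`;
(3) ∃ ε > 0, ∀ i, `spectrum (Tᵢ* Tᵢ) ⊆ {0} ∪ [ε, ∞)`. -/
theorem closed_range_iff_uniform_essential_gap
    {ι : Type*} [DecidableEq ι] {H K : ι → Type*}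
    [∀ i, NormedAddCommGroup (H i)] [∀ i, InnerProductSpace ℂ (H i)]
    [∀ i, CompleteSpace (H i)]
    [∀ i, NormedAddCommGroup (K i)] [∀ i, InnerProductSpace ℂ (K i)]
    [∀ i, CompleteSpace (K i)]
    (T : ∀ i, H i →L[ℂ] K i)
    (hbdd : ∃ C : ℝ, ∀ i, ‖T i‖ ≤ C)
    (Tsum : lp H 2 →L[ℂ] lp K 2)
    (hTsum : ∀ (i : ι) (x : H i), Tsum (lp.single 2 i x) = lp.single 2 i (T i x)) :
    (IsClosed (Set.range Tsum) ↔ ∃ ε : ℝ, 0 < ε ∧ ∀ i,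
        spectrum ℂ (T i ∘L ContinuousLinearMap.adjoint (T i)) ⊆
          insert (0 : ℂ) {z : ℂ | ∃ t : ℝ, ε ≤ t ∧ z = t}) ∧
    (IsClosed (Set.range Tsum) ↔ ∃ ε : ℝ, 0 < ε ∧ ∀ i,
        spectrum ℂ (ContinuousLinearMap.adjoint (T i) ∘L T i) ⊆
          insert (0 : ℂ) {z : ℂ | ∃ t : ℝ, ε ≤ t ∧ z = t}) := by
  have hclosed := Tsum.isClosed_range_iff_exists_isBoundedBelowOffKer
  have hswap : ∀ (ε : ℝ) i,
      spectrum ℂ (T i ∘L ContinuousLinearMap.adjoint (T i)) ⊆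
        insert (0 : ℂ) {z : ℂ | ∃ t : ℝ, ε ≤ t ∧ z = t} ↔
      spectrum ℂ (ContinuousLinearMap.adjoint (T i) ∘L T i) ⊆
        insert (0 : ℂ) {z : ℂ | ∃ t : ℝ, ε ≤ t ∧ z = t} := fun ε i =>
    ⟨ContinuousLinearMap.spectrum_comp_swap_subset_insert_zero _ _,
      ContinuousLinearMap.spectrum_comp_swap_subset_insert_zero _ _⟩
  simp only [hswap, and_self]
  rw [hclosed]
  constructor
  · rintro ⟨c, hc, h⟩
    exact ⟨c ^ 2, by positivity, fun i =>
      ((lp.isBoundedBelowOffKer_iff hTsum hc.le).mp h i).spectrum_subset hc.le⟩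
  · rintro ⟨ε, hε, h⟩
    exact ⟨√ε, Real.sqrt_pos.mpr hε, (lp.isBoundedBelowOffKer_iff hTsum (Real.sqrt_nonneg ε)).mpr
      fun i => ContinuousLinearMap.isBoundedBelowOffKer_of_spectrum_subset hε.le
        ((hswap ε i).mpr (h i))⟩
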